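/- Let T be any extension of PA_□. (1) For any n ≥ 2, if T has Bⁿ⁺¹-DP, then T has Bⁿ-DP. (2) T has Bⁿ-DP for all n ≥ 2 if and only if T has ΔB-DP. -/

import Mathlib

namespace ModalArith

/-- Terms of the language of arithmetic L_A = {0, S, +, ×, ≤, =}. -/
inductive Term : Type
  | var : ℕ → Term
  | zero : Term
  | succ : Term → Term
  | add : Term → Term → Term
  | mul : Term → Term → Term
  deriving DecidableEq

namespace Term

/-- Free variables of a term. -/
def fv : Term → Finset ℕ
  | var x => {x}
  | zero => ∅
  | succ t => fv t
  | add t u => fv t ∪ fv u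
  | mul t u => fv t ∪ fv u

/-- Simultaneous substitution of terms for variables. -/
def substAll : Term → (ℕ → Term) → Term
  | var x, v => v x
  | zero, _ => zero
  | succ t, v => succ (substAll t v)
  | add t u, v => add (substAll t v) (substAll u v)
  | mul t u, v => mul (substAll t v) (substAll u v)

/-- Substitution of the term `s` for the variable `x`. -/
def subst (x : ℕ) (s : Term) (t : Term) : Term :=
  substAll t (Function.update Term.var x s)

/-- The numeral `n̄`. -/
def numeral : ℕ → Term
  | 0 => zero
  | n + 1 => succ (numeral n)

/-- Value of a term in the standard model under a valuation. -/
def val : Term → (ℕ → ℕ) → ℕ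
  | var x, v => v x
  | zero, _ => 0
  | succ t, v => val t v + 1
  | add t u, v => val t v + val u v
  | mul t u, v => val t v * val u v

/-- A Gödel numbering of terms. -/
def code : Term → ℕ
  | var x => Nat.pair 0 x
  | zero => Nat.pair 1 0
  | succ t => Nat.pair 2 (code t)
  | add t u => Nat.pair 3 (Nat.pair (code t) (code u))
  | mul t u => Nat.pair 4 (Nat.pair (code t) (code u))

end Term

/-- Formulas of the language L_□ of modal arithmetic. -/
inductive Formula : Type
  | falsum : Formula
  | eq : Term → Term → Formula
  | le : Term → Term → Formula
  | and : Formula → Formula → Formula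
  | or : Formula → Formula → Formula
  | imp : Formula → Formula → Formula
  | neg : Formula → Formula
  | all : ℕ → Formula → Formula
  | ex : ℕ → Formula → Formula
  | box : Formula → Formula
  deriving DecidableEq

namespace Formula

/-- Free variables of a formula. -/
def fv : Formula → Finset ℕ
  | falsum => ∅
  | eq t u => t.fv ∪ u.fv
  | le t u => t.fv ∪ u.fv
  | and φ ψ => fv φ ∪ fv ψ
  | or φ ψ => fv φ ∪ fv ψ
  | imp φ ψ => fv φ ∪ fv ψ
  | neg φ => fv φ
  | all x φ => (fv φ).erase x
  | ex x φ => (fv φ).erase x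
  | box φ => fv φ

/-- Simultaneous substitution of terms for the free variables of a formula. -/
def substAll : Formula → (ℕ → Term) → Formula
  | falsum, _ => falsum
  | eq t u, v => eq (t.substAll v) (u.substAll v)
  | le t u, v => le (t.substAll v) (u.substAll v)
  | and φ ψ, v => and (substAll φ v) (substAll ψ v)
  | or φ ψ, v => or (substAll φ v) (substAll ψ v)
  | imp φ ψ, v => imp (substAll φ v) (substAll ψ v)
  | neg φ, v => neg (substAll φ v)
  | all x φ, v => all x (substAll φ (Function.update v x (Term.var x)))
  | ex x φ, v => ex x (substAll φ (Function.update v x (Term.var x)))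
  | box φ, v => box (substAll φ v)

/-- Substitution of the term `s` for the free occurrences of the variable `x`. -/
def subst (x : ℕ) (s : Term) (φ : Formula) : Formula :=
  substAll φ (Function.update Term.var x s)

/-- The term `s` is substitutable (free) for the variable `x` in the formula. -/
def freeFor (s : Term) (x : ℕ) : Formula → Prop
  | falsum => True
  | eq _ _ => True
  | le _ _ => True
  | and φ ψ => freeFor s x φ ∧ freeFor s x ψ
  | or φ ψ => freeFor s x φ ∧ freeFor s x ψ
  | imp φ ψ => freeFor s x φ ∧ freeFor s x ψ
  | neg φ => freeFor s x φ
  | all y φ => x = y ∨ x ∉ fv φ ∨ (y ∉ s.fv ∧ freeFor s x φ)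
  | ex y φ => x = y ∨ x ∉ fv φ ∨ (y ∉ s.fv ∧ freeFor s x φ)
  | box φ => freeFor s x φ

/-- The formula is an L_A-formula (contains no □). -/
def noBox : Formula → Prop
  | falsum => True
  | eq _ _ => True
  | le _ _ => True
  | and φ ψ => noBox φ ∧ noBox ψ
  | or φ ψ => noBox φ ∧ noBox ψ
  | imp φ ψ => noBox φ ∧ noBox ψ
  | neg φ => noBox φ
  | all _ φ => noBox φ
  | ex _ φ => noBox φ
  | box _ => False

/-- Truth in the standard model ℕ under a valuation (meaningful for L_A-formulas;
boxed formulas are given the dummy value `False`). -/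
def val : Formula → (ℕ → ℕ) → Prop
  | falsum, _ => False
  | eq t u, v => t.val v = u.val v
  | le t u, v => t.val v ≤ u.val v
  | and φ ψ, v => val φ v ∧ val ψ v
  | or φ ψ, v => val φ v ∨ val ψ v
  | imp φ ψ, v => val φ v → val ψ v
  | neg φ, v => ¬ val φ v
  | all x φ, v => ∀ n : ℕ, val φ (Function.update v x n)
  | ex x φ, v => ∃ n : ℕ, val φ (Function.update v x n)
  | box _, _ => False

/-- Biconditional, as an abbreviation. -/
def iff (φ ψ : Formula) : Formula := (φ.imp ψ).and (ψ.imp φ)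

/-- `t < u` abbreviates `S t ≤ u`. -/
def lt (t u : Term) : Formula := le (Term.succ t) u

/-- Bounded universal quantification `∀ x < t, φ`. -/
def ball (x : ℕ) (t : Term) (φ : Formula) : Formula :=
  all x ((lt (Term.var x) t).imp φ)

/-- Bounded existential quantification `∃ x < t, φ`. -/
def bex (x : ℕ) (t : Term) (φ : Formula) : Formula :=
  ex x ((lt (Term.var x) t).and φ)

/-- A Gödel numbering of formulas. -/
def code : Formula → ℕ
  | falsum => Nat.pair 0 0
  | eq t u => Nat.pair 1 (Nat.pair t.code u.code)
  | le t u => Nat.pair 2 (Nat.pair t.code u.code)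
  | and φ ψ => Nat.pair 3 (Nat.pair (code φ) (code ψ))
  | or φ ψ => Nat.pair 4 (Nat.pair (code φ) (code ψ))
  | imp φ ψ => Nat.pair 5 (Nat.pair (code φ) (code ψ))
  | neg φ => Nat.pair 6 (code φ)
  | all x φ => Nat.pair 7 (Nat.pair x (code φ))
  | ex x φ => Nat.pair 8 (Nat.pair x (code φ))
  | box φ => Nat.pair 9 (code φ)

end Formula

/-- A sentence is a formula with no free variables. -/
def Sentence (φ : Formula) : Prop := φ.fv = ∅

/-- Truth in the standard model ℕ (for sentences; any fixed valuation will do). -/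
def StdTrue (φ : Formula) : Prop := φ.val fun _ => 0

/-- The logical axioms of classical first-order logic with equality for L_□,
with the identity axioms only for atomic formulas. -/
inductive LogicalAxiom : Formula → Prop
  | imp1 (φ ψ : Formula) : LogicalAxiom (φ.imp (ψ.imp φ))
  | imp2 (φ ψ χ : Formula) :
      LogicalAxiom ((φ.imp (ψ.imp χ)).imp ((φ.imp ψ).imp (φ.imp χ)))
  | dne (φ : Formula) : LogicalAxiom (φ.neg.neg.imp φ)
  | negI (φ ψ : Formula) : LogicalAxiom ((φ.imp ψ).imp ((φ.imp ψ.neg).imp φ.neg))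
  | negE (φ ψ : Formula) : LogicalAxiom (φ.neg.imp (φ.imp ψ))
  | falsumE (φ : Formula) : LogicalAxiom (Formula.falsum.imp φ)
  | negIntro (φ : Formula) : LogicalAxiom ((φ.imp Formula.falsum).imp φ.neg)
  | negElimFalsum (φ : Formula) : LogicalAxiom (φ.neg.imp (φ.imp Formula.falsum))
  | andI (φ ψ : Formula) : LogicalAxiom (φ.imp (ψ.imp (φ.and ψ)))
  | andE1 (φ ψ : Formula) : LogicalAxiom ((φ.and ψ).imp φ)
  | andE2 (φ ψ : Formula) : LogicalAxiom ((φ.and ψ).imp ψ)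
  | orI1 (φ ψ : Formula) : LogicalAxiom (φ.imp (φ.or ψ))
  | orI2 (φ ψ : Formula) : LogicalAxiom (ψ.imp (φ.or ψ))
  | orE (φ ψ χ : Formula) :
      LogicalAxiom ((φ.imp χ).imp ((ψ.imp χ).imp ((φ.or ψ).imp χ)))
  | allE (x : ℕ) (t : Term) (φ : Formula) :
      φ.freeFor t x → LogicalAxiom ((Formula.all x φ).imp (φ.subst x t))
  | allImp (x : ℕ) (φ ψ : Formula) :
      x ∉ φ.fv → LogicalAxiom ((Formula.all x (φ.imp ψ)).imp (φ.imp (Formula.all x ψ)))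
  | exI (x : ℕ) (t : Term) (φ : Formula) :
      φ.freeFor t x → LogicalAxiom ((φ.subst x t).imp (Formula.ex x φ))
  | exE (x : ℕ) (φ ψ : Formula) :
      x ∉ ψ.fv → LogicalAxiom ((Formula.all x (φ.imp ψ)).imp ((Formula.ex x φ).imp ψ))
  | eqRefl (t : Term) : LogicalAxiom (Formula.eq t t)
  | eqSymm (t u : Term) : LogicalAxiom ((Formula.eq t u).imp (Formula.eq u t))
  | eqTrans (t u w : Term) :
      LogicalAxiom ((Formula.eq t u).imp ((Formula.eq u w).imp (Formula.eq t w)))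
  | eqSucc (t u : Term) :
      LogicalAxiom ((Formula.eq t u).imp (Formula.eq t.succ u.succ))
  | eqAdd (t₁ t₂ u₁ u₂ : Term) :
      LogicalAxiom ((Formula.eq t₁ t₂).imp ((Formula.eq u₁ u₂).imp
        (Formula.eq (t₁.add u₁) (t₂.add u₂))))
  | eqMul (t₁ t₂ u₁ u₂ : Term) :
      LogicalAxiom ((Formula.eq t₁ t₂).imp ((Formula.eq u₁ u₂).imp
        (Formula.eq (t₁.mul u₁) (t₂.mul u₂))))
  | eqLe (t₁ t₂ u₁ u₂ : Term) :
      LogicalAxiom ((Formula.eq t₁ t₂).imp ((Formula.eq u₁ u₂).imp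
        ((Formula.le t₁ u₁).imp (Formula.le t₂ u₂))))

/-- Provability in an L_□-theory: logical axioms, the axioms of the theory, and the
rules modus ponens, generalization, and necessitation. -/
inductive Provable (T : Set Formula) : Formula → Prop
  | ax {φ : Formula} : φ ∈ T → Provable T φ
  | logic {φ : Formula} : LogicalAxiom φ → Provable T φ
  | mp {φ ψ : Formula} : Provable T (φ.imp ψ) → Provable T φ → Provable T ψ
  | gen {φ : Formula} (x : ℕ) : Provable T φ → Provable T (Formula.all x φ)
  | nec {φ : Formula} : Provable T φ → Provable T (Formula.box φ)

/-- First-order provability (no necessitation rule); used for the non-modal theory PA. -/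
inductive FOProvable (T : Set Formula) : Formula → Prop
  | ax {φ : Formula} : φ ∈ T → FOProvable T φ
  | logic {φ : Formula} : LogicalAxiom φ → FOProvable T φ
  | mp {φ ψ : Formula} : FOProvable T (φ.imp ψ) → FOProvable T φ → FOProvable T ψ
  | gen {φ : Formula} (x : ℕ) : FOProvable T φ → FOProvable T (Formula.all x φ)

/-- Basic (Robinson-style) axioms of arithmetic. -/
def succNeZero : Formula := (Formula.eq (Term.succ (Term.var 0)) Term.zero).neg
def succInj : Formula :=
  (Formula.eq (Term.succ (Term.var 0)) (Term.succ (Term.var 1))).imp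
    (Formula.eq (Term.var 0) (Term.var 1))
def addZero : Formula := Formula.eq (Term.add (Term.var 0) Term.zero) (Term.var 0)
def addSucc : Formula :=
  Formula.eq (Term.add (Term.var 0) (Term.succ (Term.var 1)))
    (Term.succ (Term.add (Term.var 0) (Term.var 1)))
def mulZero : Formula := Formula.eq (Term.mul (Term.var 0) Term.zero) Term.zero
def mulSucc : Formula :=
  Formula.eq (Term.mul (Term.var 0) (Term.succ (Term.var 1)))
    (Term.add (Term.mul (Term.var 0) (Term.var 1)) (Term.var 0))
def leDef : Formula :=
  (Formula.le (Term.var 0) (Term.var 1)).iff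
    (Formula.ex 2 (Formula.eq (Term.add (Term.var 0) (Term.var 2)) (Term.var 1)))

def baseAxioms : Set Formula :=
  {succNeZero, succInj, addZero, addSucc, mulZero, mulSucc, leDef}

/-- The induction axiom for the formula `φ` and the variable `x`. -/
def inductionAx (x : ℕ) (φ : Formula) : Formula :=
  ((φ.subst x Term.zero).and
    (Formula.all x (φ.imp (φ.subst x (Term.succ (Term.var x)))))).imp
      (Formula.all x φ)

/-- Peano arithmetic PA: basic axioms plus induction for L_A-formulas. -/
def PA : Set Formula :=
  baseAxioms ∪ {χ | ∃ (x : ℕ) (φ : Formula), φ.noBox ∧ χ = inductionAx x φ}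

/-- PA_□ : basic axioms plus induction for all L_□-formulas. -/
def PABox : Set Formula :=
  baseAxioms ∪ {χ | ∃ (x : ℕ) (φ : Formula), χ = inductionAx x φ}

/-- The distribution axiom K. -/
def axK (φ ψ : Formula) : Formula :=
  (Formula.box (φ.imp ψ)).imp ((Formula.box φ).imp (Formula.box ψ))

/-- PA(K). -/
def PAK : Set Formula := PABox ∪ {χ | ∃ φ ψ : Formula, χ = axK φ ψ}

/-- The axiom 4. -/
def ax4 (φ : Formula) : Formula := (Formula.box φ).imp (Formula.box (Formula.box φ))

/-- PA(K4). -/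
def PAK4 : Set Formula := PAK ∪ {χ | ∃ φ : Formula, χ = ax4 φ}

/-- The axiom of Triv. -/
def axTriv (φ : Formula) : Formula := (Formula.box φ).iff φ

/-- PA(Triv). -/
def PATriv : Set Formula := PAK ∪ {χ | ∃ φ : Formula, χ = axTriv φ}

/-- PA(Ver). -/
def PAVer : Set Formula := PAK ∪ {Formula.box Formula.falsum}

/-- `T` extends `U`: every axiom of `U` is provable in `T`. -/
def Extends (T U : Set Formula) : Prop := ∀ φ ∈ U, Provable T φ

/-- Consistency. -/
def Consistent (T : Set Formula) : Prop := ¬ Provable T Formula.falsum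

/-- The class Δ₀ of bounded L_A-formulas. -/
inductive IsDelta0 : Formula → Prop
  | falsum : IsDelta0 Formula.falsum
  | eq (t u : Term) : IsDelta0 (Formula.eq t u)
  | le (t u : Term) : IsDelta0 (Formula.le t u)
  | and {φ ψ : Formula} : IsDelta0 φ → IsDelta0 ψ → IsDelta0 (φ.and ψ)
  | or {φ ψ : Formula} : IsDelta0 φ → IsDelta0 ψ → IsDelta0 (φ.or ψ)
  | imp {φ ψ : Formula} : IsDelta0 φ → IsDelta0 ψ → IsDelta0 (φ.imp ψ)
  | neg {φ : Formula} : IsDelta0 φ → IsDelta0 φ.neg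
  | ball {x : ℕ} {t : Term} {φ : Formula} :
      x ∉ t.fv → IsDelta0 φ → IsDelta0 (Formula.ball x t φ)
  | bex {x : ℕ} {t : Term} {φ : Formula} :
      x ∉ t.fv → IsDelta0 φ → IsDelta0 (Formula.bex x t φ)

/-- The class Σ₁ of L_A-formulas. -/
inductive IsSigma1 : Formula → Prop
  | delta0 {φ : Formula} : IsDelta0 φ → IsSigma1 φ
  | and {φ ψ : Formula} : IsSigma1 φ → IsSigma1 ψ → IsSigma1 (φ.and ψ)
  | or {φ ψ : Formula} : IsSigma1 φ → IsSigma1 ψ → IsSigma1 (φ.or ψ)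
  | ex {x : ℕ} {φ : Formula} : IsSigma1 φ → IsSigma1 (Formula.ex x φ)
  | ball {x : ℕ} {t : Term} {φ : Formula} :
      x ∉ t.fv → IsSigma1 φ → IsSigma1 (Formula.ball x t φ)

/-- The class B of boxed formulas. -/
def IsB (φ : Formula) : Prop := ∃ ψ : Formula, φ = Formula.box ψ

/-- The class ΔB. -/
inductive IsDeltaB : Formula → Prop
  | delta0 {φ : Formula} : IsDelta0 φ → IsDeltaB φ
  | b (ψ : Formula) : IsDeltaB (Formula.box ψ)
  | and {φ ψ : Formula} : IsDeltaB φ → IsDeltaB ψ → IsDeltaB (φ.and ψ)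
  | or {φ ψ : Formula} : IsDeltaB φ → IsDeltaB ψ → IsDeltaB (φ.or ψ)
  | ball {x : ℕ} {t : Term} {φ : Formula} :
      x ∉ t.fv → IsDeltaB φ → IsDeltaB (Formula.ball x t φ)
  | bex {x : ℕ} {t : Term} {φ : Formula} :
      x ∉ t.fv → IsDeltaB φ → IsDeltaB (Formula.bex x t φ)

/-- The class ΣB. -/
inductive IsSigmaB : Formula → Prop
  | sigma1 {φ : Formula} : IsSigma1 φ → IsSigmaB φ
  | b (ψ : Formula) : IsSigmaB (Formula.box ψ)
  | and {φ ψ : Formula} : IsSigmaB φ → IsSigmaB ψ → IsSigmaB (φ.and ψ)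
  | or {φ ψ : Formula} : IsSigmaB φ → IsSigmaB ψ → IsSigmaB (φ.or ψ)
  | ex {x : ℕ} {φ : Formula} : IsSigmaB φ → IsSigmaB (Formula.ex x φ)
  | ball {x : ℕ} {t : Term} {φ : Formula} :
      x ∉ t.fv → IsSigmaB φ → IsSigmaB (Formula.ball x t φ)

/-- Iterated disjunction (the empty disjunction is ⊥). -/
def disj : List Formula → Formula
  | [] => Formula.falsum
  | [φ] => φ
  | φ :: ψ :: l => φ.or (disj (ψ :: l))

/-- Iterated conjunction (the empty conjunction is ⊤). -/
def conj : List Formula → Formula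
  | [] => Formula.falsum.neg
  | [φ] => φ
  | φ :: ψ :: l => φ.and (conj (ψ :: l))

/-- Γ-disjunction property. -/
def HasDP (T : Set Formula) (Γ : Formula → Prop) : Prop :=
  ∀ φ ψ : Formula, Γ φ → Γ ψ → Sentence φ → Sentence ψ →
    Provable T (φ.or ψ) → Provable T φ ∨ Provable T ψ

/-- (Γ, Θ)-disjunction property. -/
def HasDP2 (T : Set Formula) (Γ Θ : Formula → Prop) : Prop :=
  ∀ φ ψ : Formula, Γ φ → Θ ψ → Sentence φ → Sentence ψ →
    Provable T (φ.or ψ) → Provable T φ ∨ Provable T ψ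

/-- Γ-existence property. -/
def HasEP (T : Set Formula) (Γ : Formula → Prop) : Prop :=
  ∀ (x : ℕ) (φ : Formula), Γ φ → φ.fv ⊆ {x} →
    Provable T (Formula.ex x φ) → ∃ n : ℕ, Provable T (φ.subst x (Term.numeral n))

/-- Modal disjunction property. -/
def HasMDP (T : Set Formula) : Prop :=
  ∀ φ ψ : Formula, Sentence φ → Sentence ψ →
    Provable T ((Formula.box φ).or (Formula.box ψ)) → Provable T φ ∨ Provable T ψ

/-- Modal existence property. -/
def HasMEP (T : Set Formula) : Prop :=
  ∀ (x : ℕ) (φ : Formula), φ.fv ⊆ {x} →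
    Provable T (Formula.ex x (Formula.box φ)) →
      ∃ n : ℕ, Provable T (φ.subst x (Term.numeral n))

/-- n-fold B-disjunction property. -/
def HasBnDP (T : Set Formula) (n : ℕ) : Prop :=
  ∀ φ : Fin n → Formula, (∀ i, Sentence (φ i)) →
    Provable T (disj (List.ofFn fun i => Formula.box (φ i))) →
    ∃ i, Provable T (Formula.box (φ i))

/-- Σ₁-soundness. -/
def Sigma1Sound (T : Set Formula) : Prop :=
  ∀ φ : Formula, IsSigma1 φ → Sentence φ → Provable T φ → StdTrue φ

/-- L_A-soundness. -/
def LASound (T : Set Formula) : Prop :=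
  ∀ φ : Formula, φ.noBox → Sentence φ → Provable T φ → StdTrue φ

/-- `T` is recursively enumerable (via the Gödel numbering of formulas). -/
def RE (T : Set Formula) : Prop :=
  Nat.Partrec fun n => Part.assert (∃ φ ∈ T, Formula.code φ = n) fun _ => Part.some 0

/-- A fixed natural Σ₁ provability predicate `Pr_T(x)` for the theory `T`:
a Σ₁ L_A-formula with only the free variable `0` which numerates provability in `T`
in the standard model and satisfies the standard derivability conditions
(provably in PA). -/
structure ProvPred (T : Set Formula) where
  pr : Formula
  noBox : pr.noBox
  sigma1 : IsSigma1 pr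
  fvSub : pr.fv ⊆ {0}
  numerates : ∀ φ : Formula,
    StdTrue (pr.subst 0 (Term.numeral φ.code)) ↔ Provable T φ
  d1 : ∀ φ : Formula, Provable T φ → FOProvable PA (pr.subst 0 (Term.numeral φ.code))
  d2 : ∀ φ ψ : Formula,
    FOProvable PA ((pr.subst 0 (Term.numeral (φ.imp ψ).code)).imp
      ((pr.subst 0 (Term.numeral φ.code)).imp (pr.subst 0 (Term.numeral ψ.code))))
  necClosed : ∀ φ : Formula,
    FOProvable PA ((pr.subst 0 (Term.numeral φ.code)).imp
      (pr.subst 0 (Term.numeral (Formula.box φ).code)))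

/-- `Pr_T(⌜φ⌝)`. -/
def ProvPred.app {T : Set Formula} (P : ProvPred T) (φ : Formula) : Formula :=
  P.pr.subst 0 (Term.numeral φ.code)

/-- Γ-disjunctive correctness (Γ-DC). -/
def DC (T : Set Formula) (P : ProvPred T) (Γ : Formula → Prop) : Prop :=
  ∀ φ : Formula, Γ φ → Sentence φ → Provable T (φ.or (P.app φ)) → Provable T φ

/-- The substitution replacing each variable by the numeral of its value. -/
def numeralSubst (v : ℕ → ℕ) : ℕ → Term := fun x => Term.numeral (v x)

/-- Standard-model satisfaction of the ρ_T-translation: `ρ_T` is the identity on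
L_A-formulas, commutes with connectives and quantifiers, and sends `□φ(x⃗)` to
`Pr_T(⌜□φ(ẋ⃗)⌝)`, whose truth in ℕ (for a natural provability predicate) amounts to
provability in `T` of `□φ(n̄⃗)`. -/
def RhoSat (T : Set Formula) : Formula → (ℕ → ℕ) → Prop
  | .falsum, _ => False
  | .eq t u, v => t.val v = u.val v
  | .le t u, v => t.val v ≤ u.val v
  | .and φ ψ, v => RhoSat T φ v ∧ RhoSat T ψ v
  | .or φ ψ, v => RhoSat T φ v ∨ RhoSat T ψ v
  | .imp φ ψ, v => RhoSat T φ v → RhoSat T ψ v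
  | .neg φ, v => ¬ RhoSat T φ v
  | .all x φ, v => ∀ n : ℕ, RhoSat T φ (Function.update v x n)
  | .ex x φ, v => ∃ n : ℕ, RhoSat T φ (Function.update v x n)
  | .box φ, v => Provable T (Formula.box (φ.substAll (numeralSubst v)))

/-- Standard-model satisfaction of the π_T-translation: `π_T` is the identity on
L_A-formulas, commutes with connectives and quantifiers, and sends `□φ(x⃗)` to
`Pr_T(⌜φ(ẋ⃗)⌝)`, whose truth in ℕ (for a natural provability predicate) amounts to
provability in `T` of `φ(n̄⃗)`. -/
def PiSat (T : Set Formula) : Formula → (ℕ → ℕ) → Prop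
  | .falsum, _ => False
  | .eq t u, v => t.val v = u.val v
  | .le t u, v => t.val v ≤ u.val v
  | .and φ ψ, v => PiSat T φ v ∧ PiSat T ψ v
  | .or φ ψ, v => PiSat T φ v ∨ PiSat T ψ v
  | .imp φ ψ, v => PiSat T φ v → PiSat T ψ v
  | .neg φ, v => ¬ PiSat T φ v
  | .all x φ, v => ∀ n : ℕ, PiSat T φ (Function.update v x n)
  | .ex x φ, v => ∃ n : ℕ, PiSat T φ (Function.update v x n)
  | .box φ, v => Provable T (φ.substAll (numeralSubst v))

/-- Weak ΣB-soundness: every provable ΣB sentence is true in ℕ under ρ_T. -/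
def WeaklySigmaBSound (T : Set Formula) : Prop :=
  ∀ φ : Formula, IsSigmaB φ → Sentence φ → Provable T φ → RhoSat T φ fun _ => 0

/-- ΣB-soundness: every provable ΣB sentence is true in ℕ under π_T. -/
def SigmaBSound (T : Set Formula) : Prop :=
  ∀ φ : Formula, IsSigmaB φ → Sentence φ → Provable T φ → PiSat T φ fun _ => 0

end ModalArith

namespace ModalArith

/-! ### Substitution lemmas -/

theorem Term.substAll_congr (t : Term) {σ τ : ℕ → Term} (h : ∀ i ∈ t.fv, σ i = τ i) :
    t.substAll σ = t.substAll τ := by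
  induction t <;> simp_all [Term.substAll, Term.fv]

theorem Term.substAll_var (t : Term) : t.substAll Term.var = t := by
  induction t <;> simp_all [Term.substAll]

theorem Term.substAll_closed (t : Term) (h : t.fv = ∅) (σ : ℕ → Term) : t.substAll σ = t := by
  rw [Term.substAll_congr t (τ := Term.var) (by simp [h]), Term.substAll_var]

theorem Term.substAll_comp (t : Term) (σ τ : ℕ → Term) :
    (t.substAll σ).substAll τ = t.substAll (fun i => (σ i).substAll τ) := by
  induction t <;> simp_all [Term.substAll]

theorem Term.fv_numeral (n : ℕ) : (Term.numeral n).fv = ∅ := by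
  induction n <;> simp_all [Term.numeral, Term.fv]

theorem Term.substAll_numeral (n : ℕ) (σ : ℕ → Term) :
    (Term.numeral n).substAll σ = Term.numeral n :=
  Term.substAll_closed _ (Term.fv_numeral n) σ

theorem Term.mem_fv_substAll (t : Term) {σ : ℕ → Term} (hσ : ∀ i, (σ i).fv ⊆ {i}) {x : ℕ}
    (h : x ∈ (t.substAll σ).fv) : x ∈ (σ x).fv := by
  induction t with
  | var y =>
    have := hσ y h
    simp at this
    subst this
    exact h
  | zero => simp [Term.substAll, Term.fv] at h
  | succ t ih => exact ih h
  | add t u iht ihu =>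
    simp only [Term.substAll, Term.fv, Finset.mem_union] at h
    exact h.elim iht ihu
  | mul t u iht ihu =>
    simp only [Term.substAll, Term.fv, Finset.mem_union] at h
    exact h.elim iht ihu

theorem Formula.substAll_congr (φ : Formula) : ∀ {σ τ : ℕ → Term}, (∀ i ∈ φ.fv, σ i = τ i) →
    φ.substAll σ = φ.substAll τ := by
  have key : ∀ (x : ℕ) (φ : Formula) (σ τ : ℕ → Term), (∀ i ∈ φ.fv.erase x, σ i = τ i) →
      ∀ i ∈ φ.fv, Function.update σ x (Term.var x) i = Function.update τ x (Term.var x) i := by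
    intro x φ σ τ h i hi
    by_cases hx : i = x
    · subst hx; simp
    · simp [hx]; exact h i (by simp [hx, hi])
  induction φ with
  | falsum => intros; rfl
  | eq t u =>
    intro σ τ h
    simp only [Formula.fv, Finset.mem_union] at h
    simp only [Formula.substAll]
    rw [Term.substAll_congr t (fun i hi => h i (Or.inl hi)),
      Term.substAll_congr u (fun i hi => h i (Or.inr hi))]
  | le t u =>
    intro σ τ h
    simp only [Formula.fv, Finset.mem_union] at h
    simp only [Formula.substAll]
    rw [Term.substAll_congr t (fun i hi => h i (Or.inl hi)),
      Term.substAll_congr u (fun i hi => h i (Or.inr hi))]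
  | and φ ψ ih1 ih2 =>
    intro σ τ h
    simp only [Formula.fv, Finset.mem_union] at h
    simp only [Formula.substAll]
    rw [ih1 (fun i hi => h i (Or.inl hi)), ih2 (fun i hi => h i (Or.inr hi))]
  | or φ ψ ih1 ih2 =>
    intro σ τ h
    simp only [Formula.fv, Finset.mem_union] at h
    simp only [Formula.substAll]
    rw [ih1 (fun i hi => h i (Or.inl hi)), ih2 (fun i hi => h i (Or.inr hi))]
  | imp φ ψ ih1 ih2 =>
    intro σ τ h
    simp only [Formula.fv, Finset.mem_union] at h
    simp only [Formula.substAll]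
    rw [ih1 (fun i hi => h i (Or.inl hi)), ih2 (fun i hi => h i (Or.inr hi))]
  | neg φ ih => intro σ τ h; simp only [Formula.substAll]; rw [ih h]
  | all x φ ih => intro σ τ h; simp only [Formula.substAll]; rw [ih (key x φ σ τ h)]
  | ex x φ ih => intro σ τ h; simp only [Formula.substAll]; rw [ih (key x φ σ τ h)]
  | box φ ih => intro σ τ h; simp only [Formula.substAll]; rw [ih h]

theorem update_var_self (x : ℕ) : Function.update Term.var x (Term.var x) = Term.var := by
  simp

theorem Formula.substAll_var (φ : Formula) : φ.substAll Term.var = φ := by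
  induction φ <;> simp_all [Formula.substAll, Term.substAll_var]

theorem Formula.substAll_sentence (φ : Formula) (h : φ.fv = ∅) (σ : ℕ → Term) :
    φ.substAll σ = φ := by
  rw [Formula.substAll_congr φ (τ := Term.var) (by simp [h]), Formula.substAll_var]

theorem Formula.subst_self (φ : Formula) (x : ℕ) : φ.subst x (Term.var x) = φ := by
  simp [Formula.subst, Formula.substAll_var]

theorem update_fv {σ : ℕ → Term} (hσ : ∀ i, (σ i).fv ⊆ {i}) (x : ℕ) (s : Term)
    (hs : s.fv ⊆ {x}) : ∀ i, (Function.update σ x s i).fv ⊆ {i} := by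
  intro i
  by_cases hx : i = x
  · subst hx; simpa using hs
  · simpa [hx] using hσ i

theorem var_fv : ∀ i, (Term.var i).fv ⊆ {i} := by intro i; simp [Term.fv]

theorem comp_update {σ : ℕ → Term} (hσ : ∀ i, (σ i).fv ⊆ {i}) (τ : ℕ → Term) (x : ℕ) :
    (fun i => (Function.update σ x (Term.var x) i).substAll (Function.update τ x (Term.var x)))
      = Function.update (fun i => (σ i).substAll τ) x (Term.var x) := by
  funext i
  by_cases hx : i = x
  · subst hx; simp [Term.substAll]
  · simp only [Function.update_of_ne hx]
    apply Term.substAll_congr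
    intro j hj
    have := hσ i hj
    simp at this
    subst this
    simp [hx]

theorem Formula.substAll_comp (φ : Formula) : ∀ {σ : ℕ → Term} (τ : ℕ → Term),
    (∀ i, (σ i).fv ⊆ {i}) →
    (φ.substAll σ).substAll τ = φ.substAll (fun i => (σ i).substAll τ) := by
  induction φ with
  | falsum => intros; rfl
  | eq t u => intros; simp [Formula.substAll, Term.substAll_comp]
  | le t u => intros; simp [Formula.substAll, Term.substAll_comp]
  | and φ ψ ih1 ih2 => intro σ τ h; simp [Formula.substAll, ih1 τ h, ih2 τ h]
  | or φ ψ ih1 ih2 => intro σ τ h; simp [Formula.substAll, ih1 τ h, ih2 τ h]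
  | imp φ ψ ih1 ih2 => intro σ τ h; simp [Formula.substAll, ih1 τ h, ih2 τ h]
  | neg φ ih => intro σ τ h; simp [Formula.substAll, ih τ h]
  | all x φ ih =>
    intro σ τ h
    simp only [Formula.substAll]
    rw [ih _ (update_fv h x _ (var_fv x)), comp_update h]
  | ex x φ ih =>
    intro σ τ h
    simp only [Formula.substAll]
    rw [ih _ (update_fv h x _ (var_fv x)), comp_update h]
  | box φ ih => intro σ τ h; simp [Formula.substAll, ih τ h]

theorem Formula.mem_fv_substAll (φ : Formula) : ∀ {σ : ℕ → Term}, (∀ i, (σ i).fv ⊆ {i}) →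
    ∀ {x : ℕ}, x ∈ (φ.substAll σ).fv → x ∈ (σ x).fv := by
  induction φ with
  | falsum => intro σ _ x h; simp [Formula.substAll, Formula.fv] at h
  | eq t u =>
    intro σ hσ x h
    simp only [Formula.substAll, Formula.fv, Finset.mem_union] at h
    exact h.elim (Term.mem_fv_substAll t hσ) (Term.mem_fv_substAll u hσ)
  | le t u =>
    intro σ hσ x h
    simp only [Formula.substAll, Formula.fv, Finset.mem_union] at h
    exact h.elim (Term.mem_fv_substAll t hσ) (Term.mem_fv_substAll u hσ)
  | and φ ψ ih1 ih2 =>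
    intro σ hσ x h
    simp only [Formula.substAll, Formula.fv, Finset.mem_union] at h
    exact h.elim (ih1 hσ) (ih2 hσ)
  | or φ ψ ih1 ih2 =>
    intro σ hσ x h
    simp only [Formula.substAll, Formula.fv, Finset.mem_union] at h
    exact h.elim (ih1 hσ) (ih2 hσ)
  | imp φ ψ ih1 ih2 =>
    intro σ hσ x h
    simp only [Formula.substAll, Formula.fv, Finset.mem_union] at h
    exact h.elim (ih1 hσ) (ih2 hσ)
  | neg φ ih => intro σ hσ x h; exact ih hσ h
  | all y φ ih =>
    intro σ hσ x h
    simp only [Formula.substAll, Formula.fv, Finset.mem_erase] at h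
    have := ih (update_fv hσ y _ (var_fv y)) h.2
    simpa [h.1] using this
  | ex y φ ih =>
    intro σ hσ x h
    simp only [Formula.substAll, Formula.fv, Finset.mem_erase] at h
    have := ih (update_fv hσ y _ (var_fv y)) h.2
    simpa [h.1] using this
  | box φ ih => intro σ hσ x h; exact ih hσ h

theorem numeralSubst_fv (v : ℕ → ℕ) : ∀ i, (numeralSubst v i).fv ⊆ {i} := by
  intro i; simp [numeralSubst, Term.fv_numeral]

theorem Formula.fv_numeralSubst (φ : Formula) (v : ℕ → ℕ) :
    (φ.substAll (numeralSubst v)).fv = ∅ := by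
  apply Finset.eq_empty_of_forall_notMem
  intro x hx
  have := Formula.mem_fv_substAll φ (numeralSubst_fv v) hx
  simp [numeralSubst, Term.fv_numeral] at this

theorem Term.fv_numeralSubst (t : Term) (v : ℕ → ℕ) :
    (t.substAll (numeralSubst v)).fv = ∅ := by
  apply Finset.eq_empty_of_forall_notMem
  intro x hx
  have := Term.mem_fv_substAll t (numeralSubst_fv v) hx
  simp [numeralSubst, Term.fv_numeral] at this

theorem Formula.freeFor_closed (φ : Formula) (s : Term) (x : ℕ) (hs : s.fv = ∅) :
    φ.freeFor s x := by
  induction φ <;> simp_all [Formula.freeFor]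

/-- Substituting a numeral after a valuation with a hole. -/
theorem Formula.subst_hole (φ : Formula) (v : ℕ → ℕ) (x k : ℕ) :
    (φ.substAll (Function.update (numeralSubst v) x (Term.var x))).subst x (Term.numeral k)
      = φ.substAll (numeralSubst (Function.update v x k)) := by
  unfold Formula.subst
  rw [Formula.substAll_comp _ _ (update_fv (numeralSubst_fv v) x _ (var_fv x))]
  congr 1
  funext i
  by_cases hx : i = x
  · subst hx; simp [Term.substAll, numeralSubst]
  · simp [hx, numeralSubst, Term.substAll_numeral]

theorem Formula.subst_succ (φ : Formula) (x k : ℕ) :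
    (φ.subst x (Term.succ (Term.var x))).subst x (Term.numeral k)
      = φ.subst x (Term.numeral (k + 1)) := by
  unfold Formula.subst
  rw [Formula.substAll_comp _ _ (update_fv var_fv x _ (by simp [Term.fv]))]
  congr 1
  funext i
  by_cases hx : i = x
  · subst hx; simp [Term.substAll, Term.numeral]
  · simp [hx, Term.substAll]

/-! ### Quantifier-free formulas (only the connectives we need) -/

def QF : Formula → Prop
  | .falsum => True
  | .eq _ _ => True
  | .le _ _ => True
  | .imp φ ψ => QF φ ∧ QF ψ
  | .neg φ => QF φ
  | _ => False

theorem QF.substAll {φ : Formula} (h : QF φ) (σ : ℕ → Term) : QF (φ.substAll σ) := by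
  induction φ <;> simp_all [QF, Formula.substAll]

theorem QF.freeFor {φ : Formula} (h : QF φ) (s : Term) (x : ℕ) : φ.freeFor s x := by
  induction φ <;> simp_all [QF, Formula.freeFor]

theorem QF.comp {φ : Formula} (h : QF φ) (σ τ : ℕ → Term) :
    (φ.substAll σ).substAll τ = φ.substAll (fun i => (σ i).substAll τ) := by
  induction φ <;> simp_all [QF, Formula.substAll, Term.substAll_comp]

/-! ### The calculus -/

namespace Provable

theorem const {T : Set Formula} {φ : Formula} (χ : Formula) (h : Provable T φ) :
    Provable T (χ.imp φ) := mp (logic (.imp1 _ _)) h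

theorem ap {T : Set Formula} {χ φ ψ : Formula} (h : Provable T (χ.imp (φ.imp ψ)))
    (h' : Provable T (χ.imp φ)) : Provable T (χ.imp ψ) := mp (mp (logic (.imp2 _ _ _)) h) h'

theorem trans {T : Set Formula} {χ φ ψ : Formula} (h : Provable T (χ.imp φ))
    (h' : Provable T (φ.imp ψ)) : Provable T (χ.imp ψ) := ap (const χ h') h

theorem refl {T : Set Formula} (φ : Formula) : Provable T (φ.imp φ) :=
  ap (ψ := φ) (φ := φ.imp φ) (logic (.imp1 _ _)) (logic (.imp1 _ _))

theorem swap {T : Set Formula} {χ φ ψ : Formula} (h : Provable T (χ.imp (φ.imp ψ))) :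
    Provable T (φ.imp (χ.imp ψ)) :=
  trans (logic (.imp1 φ χ)) (mp (logic (.imp2 _ _ _)) h)

theorem subst1 {T : Set Formula} {φ : Formula} (h : Provable T φ) (x : ℕ) (t : Term)
    (hf : φ.freeFor t x) : Provable T (φ.subst x t) :=
  mp (logic (.allE x t φ hf)) (gen x h)

theorem qfSeq {T : Set Formula} (s : Finset ℕ) : ∀ {φ : Formula}, QF φ → Provable T φ →
    ∀ σ : ℕ → Term, (∀ i, i ∉ s → σ i = Term.var i) → (∀ i ∈ s, ∀ j ∈ s, j ∉ (σ i).fv) →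
    Provable T (φ.substAll σ) := by
  induction s using Finset.induction_on with
  | empty =>
    intro φ _ h σ hσ _
    have : σ = Term.var := funext fun i => hσ i (by simp)
    rw [this, Formula.substAll_var]; exact h
  | insert a s ha ih =>
    intro φ hq h σ hσ hd
    have h1 := ih hq h (fun i => if i ∈ s then σ i else Term.var i)
      (by intro i hi; simp [hi])
      (by
        intro i hi j hj
        simp only [hi, if_true]
        exact hd i (by simp [hi]) j (by simp [hj]))
    have h2 := h1.subst1 a (σ a) ((hq.substAll _).freeFor _ _)
    unfold Formula.subst at h2
    rw [hq.comp] at h2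
    convert h2 using 2
    funext i
    by_cases hi : i ∈ s
    · simp only [hi, if_true]
      rw [Term.substAll_congr (σ i) (τ := Term.var), Term.substAll_var]
      intro j hj
      have : j ≠ a := by
        rintro rfl
        exact hd i (by simp [hi]) j (by simp) hj
      simp [this]
    · by_cases hia : i = a
      · subst hia; simp [hi, Term.substAll]
      · simp [hi, hia, Term.substAll, hσ i (by simp [hi, hia])]

/-- Instances of provable quantifier-free formulas in the variables `0, 1, 2`. -/
theorem inst {T : Set Formula} {φ : Formula} (hq : QF φ) (h : Provable T φ)
    (hv : ∀ i ∈ φ.fv, i < 3) (t u w : Term) :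
    Provable T (φ.substAll (fun i => if i = 0 then t else if i = 1 then u else
      if i = 2 then w else Term.var i)) := by
  obtain ⟨N, hN⟩ : ∃ N : ℕ, ∀ j ∈ t.fv ∪ u.fv ∪ w.fv, j < N :=
    ⟨(t.fv ∪ u.fv ∪ w.fv).sup id + 1, fun j hj =>
      Nat.lt_succ_of_le (Finset.le_sup (f := id) hj)⟩
  simp only [Finset.mem_union] at hN
  have h1 := qfSeq (T := T) (Finset.range 3) hq h
    (fun i => if i < 3 then Term.var (N + 3 + i) else Term.var i)
    (by intro i hi; simp at hi; simp [hi]) 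
    (by intro i hi j hj; simp at hi hj; simp [hi, Term.fv]; omega)
  have h2 := qfSeq (T := T) {N+3, N+4, N+5} (hq.substAll _) h1
    (fun i => if i = N + 3 then t else if i = N+4 then u else if i = N+5 then w else Term.var i)
    (by intro i hi; simp at hi; simp [hi])
    (by
      have : ∀ j, N ≤ j → j ∉ t.fv ∧ j ∉ u.fv ∧ j ∉ w.fv := by
        intro j hj
        refine ⟨fun h => ?_, fun h => ?_, fun h => ?_⟩ <;>
        · have := hN j (by simp [h]); omega
      intro i hi j hj
      have hj' := this j (by simp at hj; omega)
      simp only [Finset.mem_insert, Finset.mem_singleton] at hi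
      rcases hi with rfl | rfl | rfl <;> simp [hj'])
  rw [hq.comp] at h2
  rw [Formula.substAll_congr φ]
  · exact h2
  · intro i hi
    have := hv i hi
    interval_cases i <;> simp [Term.substAll]

end Provable

/-! ### Arithmetic in extensions of `PABox` -/

section Arith

variable {T : Set Formula}

theorem Provable.negI' {φ : Formula} (h : Provable T (φ.imp .falsum)) : Provable T φ.neg :=
  .mp (.logic (.negIntro _)) h

theorem Provable.negE' {φ : Formula} (h : Provable T φ.neg) : Provable T (φ.imp .falsum) :=
  .mp (.logic (.negElimFalsum _)) h

theorem Provable.symm' {t u : Term} (h : Provable T (.eq t u)) : Provable T (.eq u t) :=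
  .mp (.logic (.eqSymm _ _)) h

theorem Provable.eqL {a b : Term} (c : Term) (h : Provable T (.eq a b)) :
    Provable T ((Formula.eq a c).imp (.eq b c)) :=
  .mp (.logic (.eqTrans b a c)) h.symm'

theorem Provable.eqR {b c : Term} (a : Term) (h : Provable T (.eq b c)) :
    Provable T ((Formula.eq a b).imp (.eq a c)) :=
  .mp (.swap (.logic (.eqTrans a b c))) h

theorem Provable.eqT {a b c : Term} (h : Provable T (.eq a b)) (h' : Provable T (.eq b c)) :
    Provable T (.eq a c) := .mp (.eqR a h') h

theorem Provable.eqS {a b : Term} (h : Provable T (.eq a b)) :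
    Provable T (.eq a.succ b.succ) := .mp (.logic (.eqSucc _ _)) h


theorem base (hT : Extends T PABox) {φ : Formula} (h : φ ∈ baseAxioms) : Provable T φ := hT _ (Or.inl h)

theorem ind_rule (hT : Extends T PABox) (x : ℕ) (φ : Formula) (h0 : Provable T (φ.subst x .zero))
    (hs : Provable T (φ.imp (φ.subst x (.succ (.var x))))) : Provable T φ := by
  have h1 : Provable T (inductionAx x φ) := hT _ (Or.inr ⟨x, φ, rfl⟩)
  have h2 : Provable T (.all x φ) :=
    .mp h1 (.mp (.mp (.logic (.andI _ _)) h0) (.gen x hs))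
  have h3 := Provable.mp (.logic (.allE x (.var x) φ ?_)) h2
  · rwa [Formula.subst_self] at h3
  · clear h0 hs h1 h2
    have : ∀ φ : Formula, φ.freeFor (.var x) x := by
      intro φ
      induction φ <;> simp_all [Formula.freeFor, Term.fv]
      · tauto
      · tauto
    exact this φ

theorem case_rule (hT : Extends T PABox) (x : ℕ) (φ : Formula) (h0 : Provable T (φ.subst x .zero))
    (hs : Provable T (φ.subst x (.succ (.var x)))) : Provable T φ :=
  ind_rule hT x φ h0 (.const _ hs)

theorem ar_succNeZero (hT : Extends T PABox) (t : Term) : Provable T ((Formula.eq t.succ .zero).imp .falsum) := by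
  have := Provable.inst (T := T) (φ := succNeZero) (by simp [QF, succNeZero])
    (base hT (by simp [baseAxioms])) (by simp [succNeZero, Formula.fv, Term.fv]) t t t
  exact .negE' (by simpa [succNeZero, Formula.substAll, Term.substAll] using this)

theorem ar_succInj (hT : Extends T PABox) (t u : Term) :
    Provable T ((Formula.eq t.succ u.succ).imp (.eq t u)) := by
  have := Provable.inst (T := T) (φ := succInj) (by simp [QF, succInj])
    (base hT (by simp [baseAxioms])) (by simp [succInj, Formula.fv, Term.fv]) t u t
  simpa [succInj, Formula.substAll, Term.substAll] using this

theorem ar_addZero (hT : Extends T PABox) (t : Term) : Provable T (.eq (t.add .zero) t) := by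
  have := Provable.inst (T := T) (φ := addZero) (by simp [QF, addZero])
    (base hT (by simp [baseAxioms])) (by simp [addZero, Formula.fv, Term.fv]) t t t
  simpa [addZero, Formula.substAll, Term.substAll] using this

theorem ar_addSucc (hT : Extends T PABox) (t u : Term) :
    Provable T (.eq (t.add u.succ) (t.add u).succ) := by
  have := Provable.inst (T := T) (φ := addSucc) (by simp [QF, addSucc])
    (base hT (by simp [baseAxioms])) (by simp [addSucc, Formula.fv, Term.fv]) t u t
  simpa [addSucc, Formula.substAll, Term.substAll] using this

theorem ar_mulZero (hT : Extends T PABox) (t : Term) : Provable T (.eq (t.mul .zero) .zero) := by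
  have := Provable.inst (T := T) (φ := mulZero) (by simp [QF, mulZero])
    (base hT (by simp [baseAxioms])) (by simp [mulZero, Formula.fv, Term.fv]) t t t
  simpa [mulZero, Formula.substAll, Term.substAll] using this

theorem ar_mulSucc (hT : Extends T PABox) (t u : Term) :
    Provable T (.eq (t.mul u.succ) ((t.mul u).add t)) := by
  have := Provable.inst (T := T) (φ := mulSucc) (by simp [QF, mulSucc])
    (base hT (by simp [baseAxioms])) (by simp [mulSucc, Formula.fv, Term.fv]) t u t
  simpa [mulSucc, Formula.substAll, Term.substAll] using this

theorem ar_leIntro (hT : Extends T PABox) (t u w : Term) :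
    Provable T ((Formula.eq (t.add w) u).imp (.le t u)) := by
  have hd : Provable T leDef := base hT (by simp [baseAxioms])
  have h1 := Provable.mp (.logic (.andE2 _ _)) hd
  have h2 := Provable.logic (T := T) (.exI 2 (.var 2)
    (.eq (Term.add (.var 0) (.var 2)) (.var 1)) (by simp [Formula.freeFor]))
  rw [Formula.subst_self] at h2
  have h3 := h2.trans h1
  have := Provable.inst (T := T) (by simp [QF]) h3
    (by simp [Formula.fv, Term.fv]) t u w
  simpa [Formula.substAll, Term.substAll] using this

theorem ar_notLtZero (hT : Extends T PABox) (t : Term) : Provable T ((Formula.le t.succ .zero).imp .falsum) := by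
  have hd : Provable T leDef := base hT (by simp [baseAxioms])
  have h0 := Provable.mp (.logic (.andE1 _ _)) hd
  have h1 := h0.subst1 0 (.succ (.var 0)) (by simp [Formula.freeFor, Term.fv])
  have h2 := h1.subst1 1 .zero (by
    simp [Formula.freeFor, Formula.subst, Formula.substAll, Term.fv])
  simp [Formula.subst, Formula.substAll, Term.substAll, Function.update] at h2
  have h3 : Provable T ((Formula.eq (Term.add (.succ (.var 0)) (.var 2)) .zero).imp .falsum) := by
    apply case_rule hT 2
    · simp [Formula.subst, Formula.substAll, Term.substAll, Function.update]
      exact (Provable.eqL _ (ar_addZero hT _)).trans (ar_succNeZero hT _)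
    · simp [Formula.subst, Formula.substAll, Term.substAll, Function.update]
      exact (Provable.eqL _ (ar_addSucc hT _ _)).trans (ar_succNeZero hT _)
  have h4 := h2.trans (.mp (.logic (.exE 2 _ .falsum (by simp [Formula.fv]))) (.gen 2 h3))
  have := Provable.inst (T := T) (by simp [QF]) h4
    (by simp [Formula.fv, Term.fv]) t t t
  simpa [Formula.substAll, Term.substAll] using this

theorem ar_leSucc (hT : Extends T PABox) (t u : Term) : Provable T ((Formula.le t.succ u.succ).imp (.le t u)) := by
  have hd : Provable T leDef := base hT (by simp [baseAxioms])
  have h0 := Provable.mp (.logic (.andE1 _ _)) hd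
  have h1 := h0.subst1 0 (.succ (.var 0)) (by simp [Formula.freeFor, Term.fv])
  have h2 := h1.subst1 1 (.succ (.var 1)) (by
    simp [Formula.freeFor, Formula.subst, Formula.substAll, Term.fv])
  simp [Formula.subst, Formula.substAll, Term.substAll, Function.update] at h2
  have h3 : Provable T (Formula.eq (Term.add (.succ (.var 0)) (.var 2))
      (.succ (.add (.var 0) (.var 2)))) := by
    apply ind_rule hT 2
    · simp [Formula.subst, Formula.substAll, Term.substAll, Function.update]
      exact (ar_addZero hT _).eqT (ar_addZero hT _).symm'.eqS
    · simp [Formula.subst, Formula.substAll, Term.substAll, Function.update]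
      have a1 := Provable.logic (T := T) (.eqSucc (Term.add (.succ (.var 0)) (.var 2))
        (.succ (.add (.var 0) (.var 2))))
      exact (a1.trans (Provable.eqL _ (ar_addSucc hT _ _).symm')).trans
        (Provable.eqR _ (ar_addSucc hT _ _).symm'.eqS)
  have h4 := ((Provable.eqL (.succ (.var 1)) h3).trans (ar_succInj hT _ _)).trans
    (ar_leIntro hT _ _ _)
  have h5 := h2.trans (.mp (.logic (.exE 2 _ _ (by simp [Formula.fv, Term.fv]))) (.gen 2 h4))
  have := Provable.inst (T := T) (by simp [QF]) h5
    (by simp [Formula.fv, Term.fv]) t u t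
  simpa [Formula.substAll, Term.substAll] using this

theorem num_add (hT : Extends T PABox) (n m : ℕ) :
    Provable T (.eq (Term.add (.numeral n) (.numeral m)) (.numeral (n + m))) := by
  induction m with
  | zero => exact ar_addZero hT _
  | succ m ih => exact (ar_addSucc hT _ _).eqT ih.eqS

theorem eqAdd' {a b c d : Term} (h : Provable T (.eq a b)) (h' : Provable T (.eq c d)) :
    Provable T (.eq (a.add c) (b.add d)) := .mp (.mp (.logic (.eqAdd _ _ _ _)) h) h'

theorem eqMul' {a b c d : Term} (h : Provable T (.eq a b)) (h' : Provable T (.eq c d)) :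
    Provable T (.eq (a.mul c) (b.mul d)) := .mp (.mp (.logic (.eqMul _ _ _ _)) h) h'

theorem num_mul (hT : Extends T PABox) (n m : ℕ) :
    Provable T (.eq (Term.mul (.numeral n) (.numeral m)) (.numeral (n * m))) := by
  induction m with
  | zero => exact ar_mulZero hT _
  | succ m ih =>
    exact (ar_mulSucc hT _ _).eqT ((eqAdd' ih (.logic (.eqRefl _))).eqT (num_add hT _ _))

theorem num_eval (hT : Extends T PABox) (t : Term) (v : ℕ → ℕ) :
    Provable T (.eq (t.substAll (numeralSubst v)) (.numeral (t.val v))) := by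
  induction t with
  | var x => exact .logic (.eqRefl _)
  | zero => exact .logic (.eqRefl _)
  | succ t ih => exact ih.eqS
  | add t u ih1 ih2 => exact (eqAdd' ih1 ih2).eqT (num_add hT _ _)
  | mul t u ih1 ih2 => exact (eqMul' ih1 ih2).eqT (num_mul hT _ _)

theorem num_ne (hT : Extends T PABox) : ∀ (n m : ℕ), n ≠ m →
    Provable T ((Formula.eq (.numeral n) (.numeral m)).imp .falsum)
  | 0, 0, h => absurd rfl h
  | n + 1, 0, _ => ar_succNeZero hT _
  | 0, m + 1, _ => (Provable.logic (.eqSymm _ _)).trans (ar_succNeZero hT (.numeral m))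
  | n + 1, m + 1, h => (ar_succInj hT _ _).trans (num_ne hT n m (by omega))

theorem num_le (hT : Extends T PABox) (n m : ℕ) (h : n ≤ m) : Provable T (.le (.numeral n) (.numeral m)) := by
  obtain ⟨k, rfl⟩ := Nat.exists_eq_add_of_le h
  exact .mp (ar_leIntro hT _ _ _) (num_add hT n k)

theorem num_nle (hT : Extends T PABox) : ∀ (n m : ℕ), m < n →
    Provable T ((Formula.le (.numeral n) (.numeral m)).imp .falsum)
  | 0, _, h => absurd h (by omega)
  | n + 1, 0, _ => ar_notLtZero hT _
  | n + 1, m + 1, h => (ar_leSucc hT _ _).trans (num_nle hT n m (by omega))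

theorem le_congr {a b c d : Term} (h : Provable T (.eq a b)) (h' : Provable T (.eq c d)) :
    Provable T ((Formula.le a c).imp (.le b d)) := .mp (.mp (.logic (.eqLe _ _ _ _)) h) h'

/-- A formula provable at all numerals below `n` holds for all `x < n`. -/
theorem bounded (hT : Extends T PABox) (x n : ℕ) : ∀ φ : Formula,
    (∀ k < n, Provable T (φ.subst x (.numeral k))) →
    Provable T ((Formula.lt (.var x) (.numeral n)).imp φ) := by
  induction n with
  | zero =>
    intro φ _
    exact (ar_notLtZero hT _).trans (.logic (.falsumE _))
  | succ n ih =>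
    intro φ h
    apply case_rule hT x
    · exact .const _ (h 0 (by omega))
    · have h1 := ih (φ.subst x (.succ (.var x)))
        (fun k hk => by rw [Formula.subst_succ]; exact h (k + 1) (by omega))
      have h2 := (ar_leSucc hT (Term.succ (.var x)) (.numeral n)).trans h1
      simpa [Formula.subst, Formula.substAll, Term.substAll, Formula.lt, Term.numeral,
        Term.substAll_numeral] using h2

end Arith

/-! ### Disjunctions -/

theorem disj_mem {T : Set Formula} : ∀ {l : List Formula} {φ : Formula}, φ ∈ l →
    Provable T (φ.imp (disj l))
  | [ψ], φ, h => by
    simp at h; subst h; exact .refl _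
  | ψ :: χ :: l, φ, h => by
    rcases List.mem_cons.1 h with rfl | h
    · exact .logic (.orI1 _ _)
    · exact (disj_mem h).trans (.logic (.orI2 _ _))

theorem disj_elim {T : Set Formula} {χ : Formula} : ∀ {l : List Formula},
    (∀ φ ∈ l, Provable T (φ.imp χ)) → Provable T ((disj l).imp χ)
  | [], _ => .logic (.falsumE _)
  | [φ], h => h φ (by simp)
  | φ :: ψ :: l, h =>
    .mp (.mp (.logic (.orE _ _ _)) (h φ (by simp)))
      (disj_elim (l := ψ :: l) fun θ hθ => h θ (List.mem_cons_of_mem _ hθ))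

theorem disj_mono {T : Set Formula} {l l' : List Formula} (h : l ⊆ l') :
    Provable T ((disj l).imp (disj l')) := disj_elim fun _ hφ => disj_mem (h hφ)

theorem disj_fv : ∀ {l : List Formula}, (∀ φ ∈ l, φ.fv = ∅) → (disj l).fv = ∅
  | [], _ => rfl
  | [φ], h => h φ (by simp)
  | φ :: ψ :: l, h => by
    simp only [disj, Formula.fv]
    rw [h φ (by simp), disj_fv (l := ψ :: l) fun θ hθ => h θ (List.mem_cons_of_mem _ hθ)]
    rfl

/-! ### Decided formulas -/

/-- `φ` implies a disjunction of boxes of sentences satisfying `G`. -/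
def Ref (T : Set Formula) (G : Formula → Prop) (φ : Formula) : Prop :=
  ∃ L : List Formula, (∀ ψ ∈ L, Sentence ψ ∧ G ψ) ∧
    Provable T (φ.imp (disj (L.map Formula.box)))

def Dec (T : Set Formula) (G : Formula → Prop) (φ : Formula) : Prop :=
  Provable T φ ∨ Ref T G φ

section Decided

variable {T : Set Formula} {G : Formula → Prop}

theorem Ref.of_imp {φ ψ : Formula} (h : Provable T (φ.imp ψ)) : Ref T G ψ → Ref T G φ :=
  fun ⟨L, hL, hp⟩ => ⟨L, hL, h.trans hp⟩

theorem Ref.join {φ ψ : Formula} : Ref T G φ → Ref T G ψ → Ref T G (φ.or ψ) := by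
  rintro ⟨L, hL, hp⟩ ⟨L', hL', hp'⟩
  refine ⟨L ++ L', ?_, ?_⟩
  · intro ψ hψ
    rcases List.mem_append.1 hψ with h | h
    · exact hL _ h
    · exact hL' _ h
  · exact .mp (.mp (.logic (.orE _ _ _)) (hp.trans (disj_mono (by simp))))
      (hp'.trans (disj_mono (by simp)))

theorem Ref.many (f : ℕ → Formula) (n : ℕ) (h : ∀ k < n, Ref T G (f k)) :
    ∃ L : List Formula, (∀ ψ ∈ L, Sentence ψ ∧ G ψ) ∧
      ∀ k < n, Provable T ((f k).imp (disj (L.map Formula.box))) := by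
  induction n with
  | zero => exact ⟨[], by simp, by simp⟩
  | succ n ih =>
    obtain ⟨L, hL, hp⟩ := ih fun k hk => h k (by omega)
    obtain ⟨L', hL', hp'⟩ := h n (by omega)
    refine ⟨L ++ L', ?_, ?_⟩
    · intro ψ hψ
      rcases List.mem_append.1 hψ with h | h
      · exact hL _ h
      · exact hL' _ h
    · intro k hk
      by_cases hkn : k = n
      · subst hkn
        exact hp'.trans (disj_mono (by simp))
      · exact (hp k (by omega)).trans (disj_mono (by simp))

theorem Ref.of_false {φ : Formula} (h : Provable T (φ.imp .falsum)) : Ref T G φ :=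
  ⟨[], by simp, h⟩

theorem Dec.and {φ ψ : Formula} (h1 : Dec T G φ) (h2 : Dec T G ψ) : Dec T G (φ.and ψ) := by
  rcases h1 with h1 | h1
  · rcases h2 with h2 | h2
    · exact Or.inl (.mp (.mp (.logic (.andI _ _)) h1) h2)
    · exact Or.inr (h2.of_imp (.logic (.andE2 _ _)))
  · exact Or.inr (h1.of_imp (.logic (.andE1 _ _)))

theorem Dec.or {φ ψ : Formula} (h1 : Dec T G φ) (h2 : Dec T G ψ) : Dec T G (φ.or ψ) := by
  rcases h1 with h1 | h1
  · exact Or.inl (.mp (.logic (.orI1 _ _)) h1)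
  · rcases h2 with h2 | h2
    · exact Or.inl (.mp (.logic (.orI2 _ _)) h2)
    · exact Or.inr (h1.join h2)

theorem Dec.ball (hT : Extends T PABox) {x : ℕ} {t : Term} {φ : Formula} {n : ℕ} (ht : t.fv = ∅)
    (hn : Provable T (.eq t (.numeral n))) (h : ∀ k < n, Dec T G (φ.subst x (.numeral k))) :
    Dec T G (Formula.ball x t φ) := by
  by_cases hall : ∀ k < n, Provable T (φ.subst x (.numeral k))
  · left
    exact .gen x ((le_congr (.logic (.eqRefl _)) hn).trans (bounded hT x n φ hall))
  · right
    push Not at hall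
    obtain ⟨k, hk, hnp⟩ := hall
    refine ((h k hk).resolve_left hnp).of_imp ?_
    have h1 := Provable.logic (T := T) (.allE x (.numeral k)
      ((Formula.lt (.var x) t).imp φ) (Formula.freeFor_closed _ _ _ (Term.fv_numeral k)))
    have e : ((Formula.lt (.var x) t).imp φ).subst x (.numeral k) =
        (Formula.lt (.numeral k) t).imp (φ.subst x (.numeral k)) := by
      simp [Formula.subst, Formula.substAll, Formula.lt, Term.substAll,
        Term.substAll_closed t ht]
    rw [e] at h1
    exact h1.ap (.const _ (.mp (le_congr (.logic (.eqRefl _)) hn.symm')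
      (num_le hT (k + 1) n hk)))

theorem Dec.bex (hT : Extends T PABox) {x : ℕ} {t : Term} {φ : Formula} {n : ℕ} (ht : t.fv = ∅)
    (hn : Provable T (.eq t (.numeral n))) (h : ∀ k < n, Dec T G (φ.subst x (.numeral k))) :
    Dec T G (Formula.bex x t φ) := by
  by_cases hex : ∃ k < n, Provable T (φ.subst x (.numeral k))
  · left
    obtain ⟨k, hk, hp⟩ := hex
    have h1 := Provable.logic (T := T) (.exI x (.numeral k)
      ((Formula.lt (.var x) t).and φ) (Formula.freeFor_closed _ _ _ (Term.fv_numeral k)))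
    have e : ((Formula.lt (.var x) t).and φ).subst x (.numeral k) =
        (Formula.lt (.numeral k) t).and (φ.subst x (.numeral k)) := by
      simp [Formula.subst, Formula.substAll, Formula.lt, Term.substAll,
        Term.substAll_closed t ht]
    rw [e] at h1
    exact .mp h1 (.mp (.mp (.logic (.andI _ _))
      (.mp (le_congr (.logic (.eqRefl _)) hn.symm') (num_le hT (k + 1) n hk))) hp)
  · right
    push Not at hex
    obtain ⟨L, hL, hp⟩ := Ref.many (fun k => φ.subst x (.numeral k)) n
      fun k hk => (h k hk).resolve_left (hex k hk)
    refine ⟨L, hL, ?_⟩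
    have hD : (disj (L.map Formula.box)).fv = ∅ := by
      apply disj_fv
      intro ψ hψ
      obtain ⟨χ, hχ, rfl⟩ := List.mem_map.1 hψ
      exact (hL χ hχ).1
    have h1 := bounded hT x n (φ.imp (disj (L.map Formula.box))) (by
      intro k hk
      have := hp k hk
      simpa [Formula.subst, Formula.substAll, Formula.substAll_sentence _ hD] using this)
    have h2 := (le_congr (.logic (.eqRefl _)) hn).trans h1
    have h3 : Provable T (((Formula.lt (.var x) t).and φ).imp (disj (L.map Formula.box))) :=
      .ap ((Provable.logic (.andE1 _ _)).trans h2) (.logic (.andE2 _ _))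
    exact .mp (.logic (.exE x _ _ (by simp [hD]))) (.gen x h3)

theorem ball_substAll {x : ℕ} {t : Term} (φ : Formula) (hx : x ∉ t.fv) (σ : ℕ → Term) :
    (Formula.ball x t φ).substAll σ =
      Formula.ball x (t.substAll σ) (φ.substAll (Function.update σ x (.var x))) := by
  simp only [Formula.ball, Formula.substAll, Formula.lt, Term.substAll, Function.update_self]
  rw [Term.substAll_congr t (τ := σ)]
  intro i hi
  have : i ≠ x := by rintro rfl; exact hx hi
  simp [this]

theorem bex_substAll {x : ℕ} {t : Term} (φ : Formula) (hx : x ∉ t.fv) (σ : ℕ → Term) :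
    (Formula.bex x t φ).substAll σ =
      Formula.bex x (t.substAll σ) (φ.substAll (Function.update σ x (.var x))) := by
  simp only [Formula.bex, Formula.substAll, Formula.lt, Term.substAll, Function.update_self]
  rw [Term.substAll_congr t (τ := σ)]
  intro i hi
  have : i ≠ x := by rintro rfl; exact hx hi
  simp [this]

theorem Ref.falsum {φ : Formula} (h : Ref T (fun _ => False) φ) :
    Provable T (φ.imp .falsum) := by
  obtain ⟨L, hL, hp⟩ := h
  cases L with
  | nil => exact hp
  | cons a L => exact (hL a (by simp)).2.elim

theorem delta0_dec (hT : Extends T PABox) {φ : Formula} (h : IsDelta0 φ) :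
    ∀ v : ℕ → ℕ, Dec T (fun _ => False) (φ.substAll (numeralSubst v)) := by
  induction h with
  | falsum => intro v; exact Or.inr (.of_false (.refl _))
  | eq t u =>
    intro v
    by_cases h : t.val v = u.val v
    · refine Or.inl ((num_eval hT t v).eqT ?_)
      rw [h]
      exact (num_eval hT u v).symm'
    · exact Or.inr (.of_false (((Provable.eqL _ (num_eval hT t v)).trans
        (Provable.eqR _ (num_eval hT u v))).trans (num_ne hT _ _ h)))
  | le t u =>
    intro v
    by_cases h : t.val v ≤ u.val v
    · exact Or.inl (.mp (le_congr (num_eval hT t v).symm' (num_eval hT u v).symm')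
        (num_le hT _ _ h))
    · exact Or.inr (.of_false ((le_congr (num_eval hT t v) (num_eval hT u v)).trans
        (num_nle hT _ _ (by omega))))
  | and _ _ ih1 ih2 => intro v; exact (ih1 v).and (ih2 v)
  | or _ _ ih1 ih2 => intro v; exact (ih1 v).or (ih2 v)
  | imp _ _ ih1 ih2 =>
    intro v
    rcases ih2 v with h2 | h2
    · exact Or.inl (.const _ h2)
    · rcases ih1 v with h1 | h1
      · exact Or.inr (.of_false ((Provable.ap (.refl _) (.const _ h1)).trans h2.falsum))
      · exact Or.inl (h1.falsum.trans (.logic (.falsumE _)))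
  | neg _ ih =>
    intro v
    rcases ih v with h1 | h1
    · exact Or.inr (.of_false (.ap (.logic (.negElimFalsum _)) (.const _ h1)))
    · exact Or.inl (.negI' h1.falsum)
  | ball hx _ ih =>
    intro v
    rw [ball_substAll _ hx]
    refine Dec.ball hT (Term.fv_numeralSubst _ v) (num_eval hT _ v) fun k _ => ?_
    rw [Formula.subst_hole]
    exact ih _
  | bex hx _ ih =>
    intro v
    rw [bex_substAll _ hx]
    refine Dec.bex hT (Term.fv_numeralSubst _ v) (num_eval hT _ v) fun k _ => ?_
    rw [Formula.subst_hole]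
    exact ih _

theorem deltaB_dec (hT : Extends T PABox) {φ : Formula} (h : IsDeltaB φ) :
    ∀ v : ℕ → ℕ, Dec T (fun ψ => ¬ Provable T ψ.box) (φ.substAll (numeralSubst v)) := by
  induction h with
  | delta0 h =>
    intro v
    exact (delta0_dec hT h v).imp id fun h => .of_false h.falsum
  | b ψ =>
    intro v
    by_cases h : Provable T ((ψ.substAll (numeralSubst v)).box)
    · exact Or.inl h
    · refine Or.inr ⟨[ψ.substAll (numeralSubst v)], ?_, .refl _⟩
      simp only [List.mem_singleton]
      rintro _ rfl
      exact ⟨Formula.fv_numeralSubst ψ v, h⟩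
  | and _ _ ih1 ih2 => intro v; exact (ih1 v).and (ih2 v)
  | or _ _ ih1 ih2 => intro v; exact (ih1 v).or (ih2 v)
  | ball hx _ ih =>
    intro v
    rw [ball_substAll _ hx]
    refine Dec.ball hT (Term.fv_numeralSubst _ v) (num_eval hT _ v) fun k _ => ?_
    rw [Formula.subst_hole]
    exact ih _
  | bex hx _ ih =>
    intro v
    rw [bex_substAll _ hx]
    refine Dec.bex hT (Term.fv_numeralSubst _ v) (num_eval hT _ v) fun k _ => ?_
    rw [Formula.subst_hole]
    exact ih _

end Decided

theorem disj_deltaB : ∀ {l : List Formula}, (∀ φ ∈ l, IsDeltaB φ) → IsDeltaB (disj l)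
  | [], _ => .delta0 .falsum
  | [φ], h => h φ (by simp)
  | φ :: ψ :: l, h =>
    .or (h φ (by simp)) (disj_deltaB (l := ψ :: l) fun θ hθ => h θ (List.mem_cons_of_mem _ hθ))

theorem disj_dp {T : Set Formula} (h : HasDP T IsDeltaB) : ∀ {l : List Formula}, l ≠ [] →
    (∀ φ ∈ l, IsDeltaB φ) → (∀ φ ∈ l, φ.fv = ∅) → Provable T (disj l) →
    ∃ φ ∈ l, Provable T φ
  | [], hl, _, _, _ => absurd rfl hl
  | [φ], _, _, _, hp => ⟨φ, by simp, hp⟩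
  | φ :: ψ :: l, _, hd, hs, hp => by
    have hd' : ∀ θ ∈ ψ :: l, IsDeltaB θ := fun θ hθ => hd θ (List.mem_cons_of_mem _ hθ)
    have hs' : ∀ θ ∈ ψ :: l, θ.fv = ∅ := fun θ hθ => hs θ (List.mem_cons_of_mem _ hθ)
    rcases h φ (disj (ψ :: l)) (hd φ (by simp)) (disj_deltaB hd') (hs φ (by simp))
      (disj_fv hs') hp with h1 | h1
    · exact ⟨φ, by simp, h1⟩
    · obtain ⟨θ, hθ, hθp⟩ := disj_dp h (l := ψ :: l) (by simp) hd' hs' h1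
      exact ⟨θ, List.mem_cons_of_mem _ hθ, hθp⟩

/-- For T extending PA_□: (1) for n ≥ 2, Bⁿ⁺¹-DP implies Bⁿ-DP;
(2) T has Bⁿ-DP for all n ≥ 2 iff T has ΔB-DP. -/
theorem statement9 (T : Set Formula) (hT : Extends T PABox) :
    (∀ n : ℕ, 2 ≤ n → HasBnDP T (n + 1) → HasBnDP T n) ∧
    ((∀ n : ℕ, 2 ≤ n → HasBnDP T n) ↔ HasDP T IsDeltaB) := by
  refine ⟨?_, ?_, ?_⟩
  · intro n hn h φ hφ hp
    have h1 := h (Fin.cons (φ ⟨0, by omega⟩) φ)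
      (by intro i; refine Fin.cases ?_ ?_ i <;> simp [hφ])
      (by
        refine .mp (disj_mono ?_) hp
        rw [List.ofFn_succ (n := n)]
        simp)
    obtain ⟨i, hi⟩ := h1
    revert hi
    refine Fin.cases ?_ ?_ i
    · intro hi; exact ⟨_, hi⟩
    · intro i hi; exact ⟨i, by simpa using hi⟩
  · intro h φ ψ hφ hψ sφ sψ hp
    by_contra hno
    push Not at hno
    have d1 := deltaB_dec hT hφ fun _ => 0
    have d2 := deltaB_dec hT hψ fun _ => 0
    rw [Formula.substAll_sentence _ sφ] at d1
    rw [Formula.substAll_sentence _ sψ] at d2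
    obtain ⟨L, hL, hLp⟩ := (d1.resolve_left hno.1).join (d2.resolve_left hno.2)
    have hD := Provable.mp hLp hp
    match L, hL, hD with
    | [], _, hD => exact hno.1 (.mp (.logic (.falsumE _)) hD)
    | [χ], hL, hD => exact (hL χ (by simp)).2 hD
    | χ :: θ :: l, hL, hD =>
      obtain ⟨i, hi⟩ := h (χ :: θ :: l).length (by simp) (fun i => (χ :: θ :: l).get i)
        (fun i => (hL _ (List.get_mem _ i)).1)
        (by
          refine .mp (disj_mono ?_) hD
          intro a ha
          obtain ⟨b, hb, rfl⟩ := List.mem_map.1 ha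
          obtain ⟨i, rfl⟩ := List.get_of_mem hb
          exact List.mem_ofFn.2 ⟨i, rfl⟩)
      exact (hL _ (List.get_mem _ i)).2 hi
  · intro h n hn φ hφ hp
    obtain ⟨χ, hχ, hχp⟩ := disj_dp h (l := List.ofFn fun i => Formula.box (φ i))
      (by simp; omega)
      (by
        intro χ hχ
        obtain ⟨i, rfl⟩ := List.mem_ofFn.1 hχ
        exact .b _)
      (by
        intro χ hχ
        obtain ⟨i, rfl⟩ := List.mem_ofFn.1 hχ
        exact hφ i) hp
    obtain ⟨i, rfl⟩ := List.mem_ofFn.1 hχ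
    exact ⟨i, hχp⟩

end ModalArith
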